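/- arXiv:1506.00089 — 2 statements merged into one kernel-verified Lean document; each statement's English description precedes it below -/
import Mathlib

section
/- Under Condition 3 with 0 < d₁ < 1, there is a constant M₁' such that for all sufficiently large p: 0 ≤ (1/p)·Σ_{j=1}^p ( c_p/(γ_j − c_p) )² − n/p ≤ M₁'/p; that is, the Riemann sum of (c_p/(x−c_p))² over the quantiles γ_j differs from the integral ∫ (c_p/(x−c_p))² ϱ_p(x) dx = n/p by at most M₁'/p, and the sum dominates the integral. -/
open MeasureTheory Filter

/-- Left edge of the Marchenko–Pastur type law with ratio `d`. -/
noncomputable def aMP (d : ℝ) : ℝ := (1 - Real.sqrt d) ^ 2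

/-- Right edge of the Marchenko–Pastur type law with ratio `d`. -/
noncomputable def bMP (d : ℝ) : ℝ := (1 + Real.sqrt d) ^ 2

/-- The Marchenko–Pastur type density `ϱ_d`. -/
noncomputable def rhoMP (d x : ℝ) : ℝ :=
  if aMP d ≤ x ∧ x ≤ bMP d then
    (1 / (2 * Real.pi * d * x)) * Real.sqrt ((bMP d - x) * (x - aMP d))
  else 0

open intervalIntegral in
/-- The integral of `√((b - x)(x - a)) / x` over `[a, b]`, where `s` is the geometric mean of the
endpoints. -/
theorem integral_sqrt_mul_div_self {a b s : ℝ} (ha : 0 < a) (hab : a < b) (hs : 0 < s)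
    (hs2 : s ^ 2 = a * b) :
    ∫ x in a..b, Real.sqrt ((b - x) * (x - a)) / x = Real.pi * ((a + b) / 2 - s) := by
  have hba : 0 < b - a := sub_pos.2 hab
  have hne : ∀ x ∈ Set.Icc a b, x ≠ 0 := fun x hx => (ha.trans_le hx.1).ne'
  set F : ℝ → ℝ := fun x => Real.sqrt ((b - x) * (x - a))
    + (a + b) / 2 * Real.arcsin ((2 * x - a - b) / (b - a))
    - s * Real.arcsin (((a + b) * x - 2 * a * b) / (x * (b - a))) with hF
  have hcont : ContinuousOn F (Set.Icc a b) := by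
    refine ((Continuous.continuousOn (by fun_prop)).add (continuousOn_const.mul
      (Real.continuous_arcsin.comp_continuousOn (Continuous.continuousOn (by fun_prop))))).sub
      (continuousOn_const.mul (Real.continuous_arcsin.comp_continuousOn ?_))
    refine ContinuousOn.div (by fun_prop) (by fun_prop) fun x hx => ?_
    exact mul_ne_zero (hne x hx) hba.ne'
  have hderiv : ∀ x ∈ Set.Ioo a b, HasDerivAt F (Real.sqrt ((b - x) * (x - a)) / x) x := by
    intro x ⟨hxa, hxb⟩
    have hx : 0 < x := ha.trans hxa
    have hP : 0 < (b - x) * (x - a) := mul_pos (sub_pos.2 hxb) (sub_pos.2 hxa)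
    set S := Real.sqrt ((b - x) * (x - a)) with hS
    have hSpos : 0 < S := Real.sqrt_pos.2 hP
    have hS2 : S ^ 2 = (b - x) * (x - a) := Real.sq_sqrt hP.le
    have hu : 1 - ((2 * x - a - b) / (b - a)) ^ 2 = (2 * S / (b - a)) ^ 2 := by
      rw [div_pow, div_pow, mul_pow, hS2]
      field_simp
      ring
    have hv : 1 - (((a + b) * x - 2 * a * b) / (x * (b - a))) ^ 2
        = (2 * s * S / (x * (b - a))) ^ 2 := by
      rw [div_pow, div_pow, mul_pow, mul_pow, mul_pow, hS2, hs2]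
      field_simp
      ring
    have h1 : HasDerivAt (fun y => Real.sqrt ((b - y) * (y - a))) ((a + b - 2 * x) / (2 * S)) x := by
      have h := (((hasDerivAt_id x).const_sub b).mul ((hasDerivAt_id x).sub_const a)).sqrt hP.ne'
      refine h.congr_deriv ?_
      simp only [id, Pi.mul_apply]
      rw [← hS]
      ring
    have harc : ∀ (w : ℝ → ℝ) (w' q : ℝ), HasDerivAt w w' x → 0 < q → 1 - w x ^ 2 = q ^ 2 →
        HasDerivAt (fun y => Real.arcsin (w y)) (w' / q) x := by
      intro w w' q hw hq h
      have hq2 : 0 < q ^ 2 := by positivity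
      have hlt : -1 < w x ∧ w x < 1 := abs_lt.1 ((sq_lt_one_iff_abs_lt_one _).1 (by linarith))
      have h := (Real.hasDerivAt_arcsin hlt.1.ne' hlt.2.ne).comp x hw
      rw [‹1 - w x ^ 2 = q ^ 2›, Real.sqrt_sq hq.le] at h
      exact h.congr_deriv (by ring)
    have h2 := harc (fun y => (2 * y - a - b) / (b - a)) (2 / (b - a)) (2 * S / (b - a))
      (by simpa using ((((hasDerivAt_id x).const_mul 2).sub_const a).sub_const b).div_const (b - a))
      (by positivity) hu
    have h3 := harc (fun y => ((a + b) * y - 2 * a * b) / (y * (b - a)))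
      (((a + b) * (x * (b - a)) - ((a + b) * x - 2 * a * b) * (b - a)) / (x * (b - a)) ^ 2)
      (2 * s * S / (x * (b - a)))
      (((((hasDerivAt_id x).const_mul (a + b)).sub_const (2 * a * b)).div
        ((hasDerivAt_id x).mul_const (b - a)) (mul_pos hx hba).ne').congr_deriv (by simp))
      (by positivity) hv
    have h := (h1.add (h2.const_mul ((a + b) / 2))).sub (h3.const_mul s)
    refine h.congr_deriv ?_
    field_simp
    rw [hS2]
    ring
  have hint : IntervalIntegrable (fun x => Real.sqrt ((b - x) * (x - a)) / x) volume a b := by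
    refine ContinuousOn.intervalIntegrable ?_
    rw [Set.uIcc_of_le hab.le]
    exact ContinuousOn.div (by fun_prop) continuousOn_id hne
  rw [integral_eq_sub_of_hasDerivAt_of_le hab.le hcont hderiv hint]
  have e1 : (2 * b - a - b) / (b - a) = 1 := by field_simp; ring
  have e2 : (2 * a - a - b) / (b - a) = -1 := by field_simp; ring
  have e3 : ((a + b) * b - 2 * a * b) / (b * (b - a)) = 1 := by
    have : b ≠ 0 := (ha.trans hab).ne'
    field_simp
    ring
  have e4 : ((a + b) * a - 2 * a * b) / (a * (b - a)) = -1 := by field_simp; ring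
  simp only [hF, e1, e2, e3, e4, sub_self, zero_mul, mul_zero, Real.sqrt_zero, Real.arcsin_one,
    Real.arcsin_neg_one]
  ring

theorem bMP_sub_aMP (d : ℝ) : bMP d - aMP d = 4 * Real.sqrt d := by
  unfold aMP bMP
  ring

theorem aMP_lt_bMP {d : ℝ} (hd : 0 < d) : aMP d < bMP d := by
  have := bMP_sub_aMP d
  have := Real.sqrt_pos.2 hd
  linarith

theorem aMP_pos {d : ℝ} (hd : d < 1) : 0 < aMP d := by
  have : Real.sqrt d < 1 := by rw [Real.sqrt_lt' one_pos]; simpa using hd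
  unfold aMP
  have : 0 < 1 - Real.sqrt d := by linarith
  positivity

theorem aMP_le_one {d : ℝ} (hd : d < 1) : aMP d ≤ 1 := by
  have : Real.sqrt d < 1 := by rw [Real.sqrt_lt' one_pos]; simpa using hd
  unfold aMP
  nlinarith [Real.sqrt_nonneg d]

theorem bMP_le_four {d : ℝ} (hd : d < 1) : bMP d ≤ 4 := by
  have : Real.sqrt d < 1 := by rw [Real.sqrt_lt' one_pos]; simpa using hd
  unfold bMP
  nlinarith [Real.sqrt_nonneg d]

theorem rhoMP_of_mem {d x : ℝ} (hx : x ∈ Set.Icc (aMP d) (bMP d)) :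
    rhoMP d x = (1 / (2 * Real.pi * d * x)) * Real.sqrt ((bMP d - x) * (x - aMP d)) :=
  if_pos hx

theorem rhoMP_nonneg {d : ℝ} (hd : d ∈ Set.Ioo (0 : ℝ) 1) (x : ℝ) : 0 ≤ rhoMP d x := by
  unfold rhoMP
  split_ifs with h
  · have : 0 < x := (aMP_pos hd.2).trans_le h.1
    have := hd.1
    positivity
  · exact le_rfl

theorem continuousOn_rhoMP {d : ℝ} (hd : d ∈ Set.Ioo (0 : ℝ) 1) :
    ContinuousOn (rhoMP d) (Set.Icc (aMP d) (bMP d)) := by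
  refine ContinuousOn.congr ?_ fun x hx => rhoMP_of_mem hx
  refine ContinuousOn.mul (ContinuousOn.div (by fun_prop) (by fun_prop) fun x hx => ?_)
    (by fun_prop)
  have : 0 < x := (aMP_pos hd.2).trans_le hx.1
  have := hd.1
  positivity

/-- The Marchenko–Pastur density with ratio in `(0, 1)` has total mass one. -/
theorem integral_rhoMP {d : ℝ} (hd : d ∈ Set.Ioo (0 : ℝ) 1) :
    ∫ x in (aMP d)..(bMP d), rhoMP d x = 1 := by
  have h0 := hd.1
  have hsq : Real.sqrt d ^ 2 = d := Real.sq_sqrt h0.le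
  have hcongr : ∫ x in (aMP d)..(bMP d), rhoMP d x
      = ∫ x in (aMP d)..(bMP d),
          (2 * Real.pi * d)⁻¹ * (Real.sqrt ((bMP d - x) * (x - aMP d)) / x) := by
    refine intervalIntegral.integral_congr fun x hx => ?_
    rw [Set.uIcc_of_le (aMP_lt_bMP h0).le] at hx
    have : 0 < x := (aMP_pos hd.2).trans_le hx.1
    simp only [rhoMP_of_mem hx]
    field_simp
  rw [hcongr, intervalIntegral.integral_const_mul,
    integral_sqrt_mul_div_self (s := 1 - d) (aMP_pos hd.2) (aMP_lt_bMP h0) (sub_pos.2 hd.2)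
      (by unfold aMP bMP; linear_combination (2 - Real.sqrt d ^ 2 - d) * hsq)]
  have : (aMP d + bMP d) / 2 - (1 - d) = 2 * d := by
    unfold aMP bMP
    linear_combination hsq
  rw [this]
  field_simp

/-- The Riemann sum of an antitone function over the `1 / p`-quantiles, counted from the right,
of a density dominates the integral and exceeds it by at most the oscillation divided by `p`. -/
theorem riemannSum_quantiles_bounds {a b : ℝ} {p : ℕ} {g ρ : ℝ → ℝ} {γ : ℕ → ℝ} (hp : 0 < p)
    (hg : ContinuousOn g (Set.Icc a b)) (hanti : AntitoneOn g (Set.Icc a b))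
    (hρ : ContinuousOn ρ (Set.Icc a b)) (hρ0 : ∀ x, 0 ≤ ρ x)
    (h0 : γ 0 = b) (hmem : ∀ j ≤ p, γ j ∈ Set.Icc a b)
    (hq : ∀ j ≤ p, ∫ x in (γ j)..b, ρ x = (j : ℝ) / p) {k : ℕ} (hk : k ≤ p) :
    ∫ x in (γ k)..b, g x * ρ x ≤ (1 / (p : ℝ)) * ∑ j ∈ Finset.Icc 1 k, g (γ j) ∧
      (1 / (p : ℝ)) * ∑ j ∈ Finset.Icc 1 k, g (γ j)
        ≤ (∫ x in (γ k)..b, g x * ρ x) + (g (γ k) - g b) / p := by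
  have hp' : (0 : ℝ) < p := by exact_mod_cast hp
  induction k with
  | zero => simp [h0]
  | succ k ih =>
    obtain ⟨ih1, ih2⟩ := ih (by omega)
    have hm1 := hmem (k + 1) hk
    have hm0 := hmem k (by omega)
    have hbmem : b ∈ Set.Icc a b := h0 ▸ hmem 0 (Nat.zero_le p)
    have hii : ∀ {f : ℝ → ℝ}, ContinuousOn f (Set.Icc a b) → ∀ {y z}, y ∈ Set.Icc a b →
        z ∈ Set.Icc a b → IntervalIntegrable f volume y z := fun hf y z hy hz =>
      (hf.mono (Set.uIcc_subset_Icc hy hz)).intervalIntegrable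
    have hmass : ∫ x in (γ (k + 1))..(γ k), ρ x = 1 / p := by
      have h := intervalIntegral.integral_add_adjacent_intervals (hii hρ hm1 hm0)
        (hii hρ hm0 hbmem)
      rw [hq _ hk, hq k (by omega)] at h
      push_cast at h
      linear_combination h
    have hle : γ (k + 1) ≤ γ k := by
      by_contra! hlt
      have h := intervalIntegral.integral_nonneg (μ := volume) hlt.le fun x _ => hρ0 x
      rw [intervalIntegral.integral_symm, hmass] at h
      have : 0 < 1 / (p : ℝ) := by positivity
      linarith
    have hgρ : ContinuousOn (fun x => g x * ρ x) (Set.Icc a b) := hg.mul hρ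
    have hsub : ∀ x ∈ Set.Icc (γ (k + 1)) (γ k), x ∈ Set.Icc a b := fun x hx =>
      ⟨hm1.1.trans hx.1, hx.2.trans hm0.2⟩
    have hup : ∫ x in (γ (k + 1))..(γ k), g x * ρ x ≤ g (γ (k + 1)) * (1 / p) := by
      rw [← hmass, ← intervalIntegral.integral_const_mul]
      exact intervalIntegral.integral_mono_on hle (hii hgρ hm1 hm0)
        ((hii hρ hm1 hm0).const_mul _) fun x hx =>
          mul_le_mul_of_nonneg_right (hanti hm1 (hsub x hx) hx.1) (hρ0 x)
    have hlow : g (γ k) * (1 / p) ≤ ∫ x in (γ (k + 1))..(γ k), g x * ρ x := by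
      rw [← hmass, ← intervalIntegral.integral_const_mul]
      exact intervalIntegral.integral_mono_on hle ((hii hρ hm1 hm0).const_mul _)
        (hii hgρ hm1 hm0) fun x hx =>
          mul_le_mul_of_nonneg_right (hanti (hsub x hx) hm0 hx.2) (hρ0 x)
    rw [← intervalIntegral.integral_add_adjacent_intervals (hii hgρ hm1 hm0)
        (hii hgρ hm0 hbmem), Finset.sum_Icc_succ_top (by omega), mul_add]
    refine ⟨by linarith, ?_⟩
    have e : (g (γ (k + 1)) - g b) / p
        = 1 / p * g (γ (k + 1)) - g (γ k) * (1 / p) + (g (γ k) - g b) / p := by ring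
    rw [e]
    linarith

theorem continuousOn_sq_div_sub {a c : ℝ} (b : ℝ) (hc : c < a) :
    ContinuousOn (fun x => (c / (x - c)) ^ 2) (Set.Icc a b) :=
  (ContinuousOn.div (by fun_prop) (by fun_prop) fun _ hx =>
    (sub_pos.2 (hc.trans_le hx.1)).ne').pow 2

theorem antitoneOn_sq_div_sub {a c : ℝ} (b : ℝ) (hc0 : 0 < c) (hc : c < a) :
    AntitoneOn (fun x => (c / (x - c)) ^ 2) (Set.Icc a b) := by
  intro x hx y hy hxy
  have h1 : 0 < x - c := sub_pos.2 (hc.trans_le hx.1)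
  have h2 : 0 < y - c := sub_pos.2 (hc.trans_le hy.1)
  dsimp only
  gcongr

/-- A bound on `∫ (c / (x - c))² ϱ_d(x) dx` keeps `c` away from the left edge, uniformly for `d`
bounded away from the endpoints of `(0, 1)`. -/
theorem exists_le_aMP_sub {α β N : ℝ} (hα : 0 < α) (hβ : 0 < β) (hN : 0 < N) :
    ∃ δ₀ > 0, ∀ d ∈ Set.Ioo (0 : ℝ) 1, α ≤ aMP d → β ≤ bMP d - aMP d →
      ∀ c ∈ Set.Ioo 0 (aMP d),
        ∫ x in (aMP d)..(bMP d), (c / (x - c)) ^ 2 * rhoMP d x ≤ N → δ₀ ≤ aMP d - c := by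
  set K : ℝ := α ^ 2 / 36 * (Real.sqrt (β / 2) / (8 * Real.pi)) with hK
  have hKpos : 0 < K := by positivity
  refine ⟨min (min (α / 2) (β / 4)) ((K / N) ^ 2), by positivity, ?_⟩
  intro d hd hαd hβd c hc hI
  by_contra! hlt
  obtain ⟨hlt', h3⟩ := lt_min_iff.1 hlt
  obtain ⟨h1, h2⟩ := lt_min_iff.1 hlt'
  have hδ : 0 < aMP d - c := sub_pos.2 hc.2
  have hb4 := bMP_le_four hd.2
  have hd0 := hd.1
  set a := aMP d with ha
  set b := bMP d with hb
  set δ := a - c with hδdef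
  have hcont : ContinuousOn (fun x => (c / (x - c)) ^ 2 * rhoMP d x) (Set.Icc a b) :=
    (continuousOn_sq_div_sub b hc.2).mul (continuousOn_rhoMP hd)
  have hab : a ≤ b := by linarith
  have hi : IntervalIntegrable (fun x => (c / (x - c)) ^ 2 * rhoMP d x) volume a b :=
    ContinuousOn.intervalIntegrable (by rwa [Set.uIcc_of_le hab])
  have hi' : IntervalIntegrable (fun x => (c / (x - c)) ^ 2 * rhoMP d x) volume (a + δ)
      (a + 2 * δ) :=
    (hcont.mono (Set.uIcc_subset_Icc ⟨by linarith, by linarith⟩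
      ⟨by linarith, by linarith⟩)).intervalIntegrable
  have hmono : ∫ x in (a + δ)..(a + 2 * δ), (c / (x - c)) ^ 2 * rhoMP d x
      ≤ ∫ x in a..b, (c / (x - c)) ^ 2 * rhoMP d x :=
    intervalIntegral.integral_mono_interval (by linarith) (by linarith) (by linarith)
      (ae_of_all _ fun x => mul_nonneg (sq_nonneg _) (rhoMP_nonneg hd x)) hi
  have hpt : ∀ x ∈ Set.Icc (a + δ) (a + 2 * δ),
      K * Real.sqrt δ / δ ^ 2 ≤ (c / (x - c)) ^ 2 * rhoMP d x := by
    intro x hx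
    have hxI : x ∈ Set.Icc a b := ⟨by linarith [hx.1], by linarith [hx.2]⟩
    have hx0 : 0 < x := by linarith [hxI.1]
    have e : K * Real.sqrt δ / δ ^ 2
        = (α / 2 / (3 * δ)) ^ 2 * (1 / (2 * Real.pi * 1 * 4) * Real.sqrt (β / 2 * δ)) := by
      rw [hK, Real.sqrt_mul (by positivity)]
      field_simp
      ring
    rw [e, rhoMP_of_mem hxI]
    have hxc : 0 < x - c := by linarith [hxI.1]
    have t1 : α / 2 ≤ c := by linarith
    have t2 : x - c ≤ 3 * δ := by linarith [hx.2]
    have t3 : β / 2 ≤ b - x := by linarith [hx.2]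
    have t4 : δ ≤ x - a := by linarith [hx.1]
    have t5 : x ≤ 4 := hxI.2.trans hb4
    have t6 : d ≤ 1 := hd.2.le
    have t7 : 0 ≤ c := hc.1.le
    have t8 : 0 ≤ b - x := by linarith
    gcongr
  have hlow : δ * (K * Real.sqrt δ / δ ^ 2)
      ≤ ∫ x in (a + δ)..(a + 2 * δ), (c / (x - c)) ^ 2 * rhoMP d x := by
    have h := intervalIntegral.integral_mono_on (μ := volume) (by linarith)
      intervalIntegrable_const hi' hpt
    rw [intervalIntegral.integral_const, smul_eq_mul] at h
    linarith
  have hs : 0 < Real.sqrt δ := Real.sqrt_pos.2 hδ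
  have hKN : K / Real.sqrt δ ≤ N := by
    have e : δ * (K * Real.sqrt δ / δ ^ 2) = K / Real.sqrt δ := by
      field_simp
      rw [Real.sq_sqrt hδ.le]
    rw [← e]
    linarith
  have hsK : Real.sqrt δ < K / N := by
    rw [Real.sqrt_lt' (by positivity)]
    exact h3
  rw [lt_div_iff₀ hN] at hsK
  rw [div_le_iff₀ hs] at hKN
  linarith

/-- under Condition 3 with `0 < d₁ < 1`, there is a constant `M₁'` such that
for all large `p`, `0 ≤ (1/p)Σ_{j=1}^p (c_p/(γ_j − c_p))² − n/p ≤ M₁'/p`: the Riemann sum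
over the quantiles dominates the integral `∫ (c_p/(x−c_p))² ϱ_p(x) dx = n/p` and differs
from it by at most `M₁'/p`. -/
theorem stmt_12 (m n : ℕ → ℕ) (d₁ d₂ d₃ : ℝ)
    (hd₁ : d₁ ∈ Set.Ioo (0 : ℝ) 1) (hd₂ : 0 < d₂) (hd₃ : d₃ ∈ Set.Ioo (0 : ℝ) 1)
    (hm : Tendsto (fun p : ℕ => (p : ℝ) / m p) atTop (nhds d₁))
    (hn : Tendsto (fun p : ℕ => (p : ℝ) / n p) atTop (nhds d₂))
    (hmn : Tendsto (fun p : ℕ => (p : ℝ) / ((m p : ℝ) + n p)) atTop (nhds d₃))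
    (c : ℕ → ℝ)
    (hc : ∀ᶠ p : ℕ in atTop,
      c p ∈ Set.Ioo 0 (aMP ((p : ℝ) / m p)) ∧
      (∫ x in (aMP ((p : ℝ) / m p))..(bMP ((p : ℝ) / m p)),
          (c p / (x - c p)) ^ 2 * rhoMP ((p : ℝ) / m p) x) = (n p : ℝ) / p)
    (γq : ℕ → ℕ → ℝ)
    (hγq : ∀ᶠ p : ℕ in atTop,
      γq p 0 = bMP ((p : ℝ) / m p) ∧ γq p p = aMP ((p : ℝ) / m p) ∧
      ∀ j, 1 ≤ j → j ≤ p - 1 →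
        γq p j ∈ Set.Ioo (aMP ((p : ℝ) / m p)) (bMP ((p : ℝ) / m p)) ∧
        (∫ x in (γq p j)..(bMP ((p : ℝ) / m p)), rhoMP ((p : ℝ) / m p) x) = (j : ℝ) / p) :
    ∃ M₁' : ℝ, ∀ᶠ p : ℕ in atTop,
      0 ≤ (1 / (p : ℝ)) * ∑ j ∈ Finset.Icc 1 p, (c p / (γq p j - c p)) ^ 2 - (n p : ℝ) / p ∧
      (1 / (p : ℝ)) * ∑ j ∈ Finset.Icc 1 p, (c p / (γq p j - c p)) ^ 2 - (n p : ℝ) / p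
        ≤ M₁' / p := by
  have hcd : ContinuousAt aMP d₁ := by unfold aMP; fun_prop
  have hα := aMP_pos hd₁.2
  have hβ := Real.sqrt_pos.2 hd₁.1
  obtain ⟨δ₀, hδ₀, hδ⟩ := exists_le_aMP_sub (α := aMP d₁ / 2) (β := 2 * Real.sqrt d₁)
    (N := d₂⁻¹ + 1) (by positivity) (by positivity) (by positivity)
  refine ⟨(1 / δ₀) ^ 2, ?_⟩
  have ev1 : ∀ᶠ p : ℕ in atTop, (p : ℝ) / m p ∈ Set.Ioo (0 : ℝ) 1 :=
    hm.eventually (isOpen_Ioo.mem_nhds hd₁)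
  have ev2 : ∀ᶠ p : ℕ in atTop, aMP d₁ / 2 < aMP ((p : ℝ) / m p) :=
    (hcd.tendsto.comp hm).eventually (lt_mem_nhds (half_lt_self hα))
  have ev3 : ∀ᶠ p : ℕ in atTop, Real.sqrt d₁ / 2 < Real.sqrt ((p : ℝ) / m p) :=
    ((Real.continuous_sqrt.tendsto d₁).comp hm).eventually (lt_mem_nhds (half_lt_self hβ))
  have ev4 : ∀ᶠ p : ℕ in atTop, ((p : ℝ) / n p)⁻¹ < d₂⁻¹ + 1 :=
    (hn.inv₀ hd₂.ne').eventually (gt_mem_nhds (lt_add_one _))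
  filter_upwards [ev1, ev2, ev3, ev4, hc, hγq, eventually_gt_atTop 0] with
    p hp1 hp2 hp3 hp4 ⟨hcp, hint⟩ ⟨hγ0, hγp, hγ⟩ hp
  rw [inv_div] at hp4
  set d := (p : ℝ) / m p with hd
  have hab := aMP_lt_bMP hp1.1
  have hpR : (0 : ℝ) < p := by exact_mod_cast hp
  have hδp := hδ d hp1 hp2.le (by rw [bMP_sub_aMP]; linarith) (c p) hcp (by rw [hint]; exact hp4.le)
  have hq : ∀ j ≤ p, γq p j ∈ Set.Icc (aMP d) (bMP d) ∧
      ∫ x in (γq p j)..(bMP d), rhoMP d x = (j : ℝ) / p := by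
    intro j hj
    rcases Nat.eq_zero_or_pos j with rfl | hj0
    · simp [hγ0, hab.le]
    rcases hj.eq_or_lt with rfl | hjp
    · simp [hγp, hab.le, integral_rhoMP hp1, hpR.ne']
    · exact ⟨Set.Ioo_subset_Icc_self (hγ j hj0 (by omega)).1, (hγ j hj0 (by omega)).2⟩
  obtain ⟨hlow, hup⟩ := riemannSum_quantiles_bounds (γ := γq p) hp
    (continuousOn_sq_div_sub (bMP d) hcp.2) (antitoneOn_sq_div_sub (bMP d) hcp.1 hcp.2)
    (continuousOn_rhoMP hp1) (rhoMP_nonneg hp1) hγ0 (fun j hj => (hq j hj).1)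
    (fun j hj => (hq j hj).2) le_rfl
  rw [hγp, hint] at hlow hup
  refine ⟨sub_nonneg.2 hlow, sub_le_iff_le_add'.2 (hup.trans ?_)⟩
  have hcp0 := hcp.1.le
  have hcp1 : c p ≤ 1 := hcp.2.le.trans (aMP_le_one hp1.2)
  have hedge : (c p / (aMP d - c p)) ^ 2 ≤ (1 / δ₀) ^ 2 := by
    have : 0 < aMP d - c p := sub_pos.2 hcp.2
    gcongr
  gcongr
  linarith [sq_nonneg (c p / (bMP d - c p))]
end

section
/- Let m < p and n be positive integers, let D be an m×m invertible real matrix, and let X be a p×n real matrix written in block form X = [X₁; X₂] with X₁ of size m×n and X₂ of size (p−m)×n. Assume X₂X₂ᵀ is invertible. Then for every λ ∈ ℝ, det( λ·diag(D, 0_{p−m}) − X·Xᵀ ) = (−1)^{p−m}·det(X₂X₂ᵀ)·det( λ·D − X₁·(I_n − X₂ᵀ(X₂X₂ᵀ)^{−1}X₂)·X₁ᵀ ). In particular, λ is a root of det(λ·diag(D,0) − XXᵀ) = 0 if and only if it is a root of det( λ·D − X₁(I_n − X₂ᵀ(X₂X₂ᵀ)^{−1}X₂)X₁ᵀ ) =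 0. -/
open Matrix

/-- Schur complement formula for the determinant of a block matrix minus a Gram matrix. -/
theorem det_fromBlocks_sub_fromRows_mul_transpose {m k n R : Type*} [Fintype m] [DecidableEq m]
    [Fintype k] [DecidableEq k] [Fintype n] [DecidableEq n] [CommRing R]
    (A : Matrix m m R) (X₁ : Matrix m n R) (X₂ : Matrix k n R) (hX₂ : IsUnit (X₂ * X₂ᵀ).det) :
    (fromBlocks A 0 0 (0 : Matrix k k R) - fromRows X₁ X₂ * (fromRows X₁ X₂)ᵀ).det =
      (-1) ^ Fintype.card k * (X₂ * X₂ᵀ).det *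
        (A - X₁ * (1 - X₂ᵀ * (X₂ * X₂ᵀ)⁻¹ * X₂) * X₁ᵀ).det := by
  let _ : Invertible (X₂ * X₂ᵀ) := invertibleOfIsUnitDet _ hX₂
  let _ : Invertible (-(X₂ * X₂ᵀ)) := invertibleNeg _
  have hblocks : fromBlocks A 0 0 (0 : Matrix k k R) - fromRows X₁ X₂ * (fromRows X₁ X₂)ᵀ =
      fromBlocks (A - X₁ * X₁ᵀ) (-(X₁ * X₂ᵀ)) (-(X₂ * X₁ᵀ)) (-(X₂ * X₂ᵀ)) := by
    rw [transpose_fromRows, fromRows_mul_fromCols, sub_eq_add_neg, fromBlocks_neg,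
      fromBlocks_add]
    simp only [zero_add, sub_eq_add_neg]
  rw [hblocks, det_fromBlocks₂₂, det_neg, invOf_neg, invOf_eq_nonsing_inv]
  congr 2
  simp only [Matrix.mul_sub, Matrix.sub_mul, Matrix.neg_mul, Matrix.mul_neg, Matrix.mul_one,
    neg_neg, Matrix.mul_assoc]
  abel

/-- for `m < p = m + k`, an invertible `m×m` matrix `D`, and a `p×n` matrix
`X = [X₁; X₂]` with `X₂X₂ᵀ` invertible, for every `λ ∈ ℝ`,
`det(λ·diag(D,0) − XXᵀ) = (−1)^{p−m}·det(X₂X₂ᵀ)·det(λD − X₁(Iₙ − X₂ᵀ(X₂X₂ᵀ)⁻¹X₂)X₁ᵀ)`;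
in particular `λ` is a root of the first determinant iff it is a root of the second. -/
theorem stmt_15 (mm k n : ℕ) (hm : 0 < mm) (hk : 0 < k) (hn : 0 < n)
    (D : Matrix (Fin mm) (Fin mm) ℝ) (hD : IsUnit D.det)
    (X₁ : Matrix (Fin mm) (Fin n) ℝ) (X₂ : Matrix (Fin k) (Fin n) ℝ)
    (hX₂ : IsUnit (X₂ * X₂ᵀ).det) :
    ∀ l : ℝ,
      (Matrix.fromBlocks (l • D) 0 0 (0 : Matrix (Fin k) (Fin k) ℝ)
          - Matrix.fromRows X₁ X₂ * (Matrix.fromRows X₁ X₂)ᵀ).det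
        = (-1 : ℝ) ^ k * (X₂ * X₂ᵀ).det *
            (l • D - X₁ * ((1 : Matrix (Fin n) (Fin n) ℝ) - X₂ᵀ * (X₂ * X₂ᵀ)⁻¹ * X₂) * X₁ᵀ).det
      ∧ ((Matrix.fromBlocks (l • D) 0 0 (0 : Matrix (Fin k) (Fin k) ℝ)
            - Matrix.fromRows X₁ X₂ * (Matrix.fromRows X₁ X₂)ᵀ).det = 0 ↔
          (l • D - X₁ * ((1 : Matrix (Fin n) (Fin n) ℝ)
            - X₂ᵀ * (X₂ * X₂ᵀ)⁻¹ * X₂) * X₁ᵀ).det = 0) := by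
  intro l
  have hdet := det_fromBlocks_sub_fromRows_mul_transpose (l • D) X₁ X₂ hX₂
  rw [Fintype.card_fin] at hdet
  refine ⟨hdet, ?_⟩
  rw [hdet, mul_eq_zero, or_iff_right]
  exact mul_ne_zero (pow_ne_zero _ (neg_ne_zero.mpr one_ne_zero)) hX₂.ne_zero
end
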